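/- For any point placement P of n points, (n − 4)·Q(P) = 5·P₅(P) + 3·U(P) + T₂(P), where Q(P) is the number of 4-element subsets of P in convex position. -/

import Mathlib

open Finset

/-- A finite set of points in the plane is in *general position* if no three of
its points are collinear. -/
def GenPos (P : Finset (ℝ × ℝ)) : Prop :=
  ∀ x ∈ P, ∀ y ∈ P, ∀ z ∈ P, x ≠ y → x ≠ z → y ≠ z →
    ¬ Collinear ℝ ({x, y, z} : Set (ℝ × ℝ))

/-- A finite set of points is in *convex position* if every point of it is an
extreme point of its convex hull. -/
def ConvexPos (S : Finset (ℝ × ℝ)) : Prop :=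
  ∀ x ∈ S, x ∈ Set.extremePoints ℝ (convexHull ℝ (S : Set (ℝ × ℝ)))

open scoped Classical in
/-- Number of `k`-element subsets of `P` that are in convex position. -/
noncomputable def convexPosCount (P : Finset (ℝ × ℝ)) (k : ℕ) : ℕ :=
  ((P.powersetCard k).filter fun S => ConvexPos S).card

/-- `mu k n` is the minimum number of `k`-element subsets in convex position over
all placements of `n` points in general position. -/
noncomputable def mu (k n : ℕ) : ℕ :=
  sInf {m | ∃ P : Finset (ℝ × ℝ), GenPos P ∧ P.card = n ∧ convexPosCount P k = m}

/-- `x` is a γ-point of `T` if `T ∪ {x}` is in convex position. -/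
def IsGammaPt (T : Finset (ℝ × ℝ)) (x : ℝ × ℝ) : Prop :=
  ConvexPos (insert x T)

/-- `x` is a β-point of `T` if `T ∪ {x}` is not in convex position and `x` does not
lie in the convex hull of `T`. -/
def IsBetaPt (T : Finset (ℝ × ℝ)) (x : ℝ × ℝ) : Prop :=
  ¬ ConvexPos (insert x T) ∧ x ∉ convexHull ℝ (T : Set (ℝ × ℝ))

open scoped Classical in
/-- `γ_T`: number of γ-points of `T` among the points of `P \ T`. -/
noncomputable def gammaCount (P T : Finset (ℝ × ℝ)) : ℕ :=
  ((P \ T).filter fun x => IsGammaPt T x).card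

open scoped Classical in
/-- `β_T`: number of β-points of `T` among the points of `P \ T`. -/
noncomputable def betaCount (P T : Finset (ℝ × ℝ)) : ℕ :=
  ((P \ T).filter fun x => IsBetaPt T x).card

open scoped Classical in
/-- Number of `k`-element subsets of `P` whose convex hull has exactly `j`
extreme points. -/
noncomputable def hullCount (P : Finset (ℝ × ℝ)) (k j : ℕ) : ℕ :=
  ((P.powersetCard k).filter fun S =>
    (Set.extremePoints ℝ (convexHull ℝ (S : Set (ℝ × ℝ)))).ncard = j).card

/-- `x` and `y` lie strictly on the same side of the line through `p` and `q`. -/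
def SameSide (p q x y : ℝ × ℝ) : Prop :=
  0 < ((q.1 - p.1) * (x.2 - p.2) - (q.2 - p.2) * (x.1 - p.1)) *
      ((q.1 - p.1) * (y.2 - p.2) - (q.2 - p.2) * (y.1 - p.1))

/-- `x` and `y` lie in the same region with respect to `T`: for each pair of
distinct points of `T`, they lie strictly on the same side of the line through them. -/
def SameRegion (T : Finset (ℝ × ℝ)) (x y : ℝ × ℝ) : Prop :=
  ∀ p ∈ T, ∀ q ∈ T, p ≠ q → SameSide p q x y

open scoped Classical in
/-- Number of 2-element subsets `{x, y}` of `P \ T` such that `x` and `y` are both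
γ-points of `T` lying in the same region with respect to `T`. -/
noncomputable def gammaSamePairs (P T : Finset (ℝ × ℝ)) : ℕ :=
  (((P \ T).powersetCard 2).filter fun S =>
    (∀ x ∈ S, IsGammaPt T x) ∧ ∀ x ∈ S, ∀ y ∈ S, x ≠ y → SameRegion T x y).card

open scoped Classical in
/-- Number of 2-element subsets `{x, y}` of `P \ T` such that `x` and `y` are both
γ-points of `T` lying in distinct regions with respect to `T`. -/
noncomputable def gammaDiffPairs (P T : Finset (ℝ × ℝ)) : ℕ :=
  (((P \ T).powersetCard 2).filter fun S =>
    (∀ x ∈ S, IsGammaPt T x) ∧ ∀ x ∈ S, ∀ y ∈ S, x ≠ y → ¬ SameRegion T x y).card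

open scoped Classical in
/-- Number of 2-element subsets `{x, y}` of `P \ T` such that `x` and `y` are both
β-points of `T` lying in the same region with respect to `T`. -/
noncomputable def betaSamePairs (P T : Finset (ℝ × ℝ)) : ℕ :=
  (((P \ T).powersetCard 2).filter fun S =>
    (∀ x ∈ S, IsBetaPt T x) ∧ ∀ x ∈ S, ∀ y ∈ S, x ≠ y → SameRegion T x y).card

open scoped Classical in
/-- Number of 2-element subsets `{x, y}` of `P \ T` such that `x` and `y` are both
β-points of `T` lying in distinct regions with respect to `T`. -/
noncomputable def betaDiffPairs (P T : Finset (ℝ × ℝ)) : ℕ :=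
  (((P \ T).powersetCard 2).filter fun S =>
    (∀ x ∈ S, IsBetaPt T x) ∧ ∀ x ∈ S, ∀ y ∈ S, x ≠ y → ¬ SameRegion T x y).card

open scoped Classical in
/-- The points of `S` that lie in the convex hull of the remaining ones. -/
noncomputable def innerPts (S : Finset (ℝ × ℝ)) : Finset (ℝ × ℝ) :=
  S.filter fun x => x ∈ convexHull ℝ (↑(S.erase x) : Set (ℝ × ℝ))

/-- Twice the signed area of the triangle `x a b`. -/
def signedArea (x a b : ℝ × ℝ) : ℝ :=
  (a.1 - x.1) * (b.2 - x.2) - (a.2 - x.2) * (b.1 - x.1)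

theorem GenPos.mono {S T : Finset (ℝ × ℝ)} (h : GenPos T) (hST : S ⊆ T) : GenPos S :=
  fun x hx y hy z hz => h x (hST hx) y (hST hy) z (hST hz)

theorem convexHull_extremePoints_convexHull (S : Finset (ℝ × ℝ)) :
    convexHull ℝ (Set.extremePoints ℝ (convexHull ℝ (S : Set (ℝ × ℝ)))) =
      convexHull ℝ (S : Set (ℝ × ℝ)) := by
  have hfin : (Set.extremePoints ℝ (convexHull ℝ (S : Set (ℝ × ℝ)))).Finite :=
    S.finite_toSet.subset extremePoints_convexHull_subset
  have h := closure_convexHull_extremePoints (S.finite_toSet.isCompact_convexHull ℝ)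
    (convex_convexHull ℝ (S : Set (ℝ × ℝ)))
  rwa [(hfin.isClosed_convexHull ℝ).closure_eq] at h

theorem mem_extremePoints_convexHull_iff {S : Finset (ℝ × ℝ)} {x : ℝ × ℝ} (hx : x ∈ S) :
    x ∈ Set.extremePoints ℝ (convexHull ℝ (S : Set (ℝ × ℝ))) ↔
      x ∉ convexHull ℝ (↑(S.erase x) : Set (ℝ × ℝ)) := by
  constructor
  · intro hext hmem
    have heq : convexHull ℝ (S : Set (ℝ × ℝ)) = convexHull ℝ (↑(S.erase x) : Set (ℝ × ℝ)) := by
      refine (convexHull_min ?_ (convex_convexHull ℝ _)).antisymm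
        (convexHull_mono (by simp))
      intro y hy
      by_cases hyx : y = x
      · rwa [hyx]
      · exact subset_convexHull ℝ _ (by simpa [hyx] using hy)
    rw [heq] at hext
    simpa using extremePoints_convexHull_subset hext
  · intro hmem
    by_contra hext
    apply hmem
    have hx' : x ∈ convexHull ℝ (S : Set (ℝ × ℝ)) := subset_convexHull ℝ _ hx
    rw [← convexHull_extremePoints_convexHull] at hx'
    refine convexHull_mono (fun y hy => ?_) hx'
    have hyS : y ∈ S := extremePoints_convexHull_subset hy
    have hyx : y ≠ x := by rintro rfl; exact hext hy
    simp [hyx, hyS]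

theorem extremePoints_convexHull_eq_sdiff (S : Finset (ℝ × ℝ)) :
    Set.extremePoints ℝ (convexHull ℝ (S : Set (ℝ × ℝ))) = ↑(S \ innerPts S) := by
  ext x
  by_cases hx : x ∈ S
  · simp [mem_extremePoints_convexHull_iff hx, innerPts, hx]
  · have : x ∉ Set.extremePoints ℝ (convexHull ℝ (S : Set (ℝ × ℝ))) :=
      fun h => hx (extremePoints_convexHull_subset h)
    simp [this, hx]

open scoped Classical in
theorem innerPts_subset (S : Finset (ℝ × ℝ)) : innerPts S ⊆ S := by
  exact filter_subset _ _

theorem ncard_extremePoints_add_card_innerPts (S : Finset (ℝ × ℝ)) :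
    (Set.extremePoints ℝ (convexHull ℝ (S : Set (ℝ × ℝ)))).ncard + (innerPts S).card =
      S.card := by
  rw [extremePoints_convexHull_eq_sdiff, Set.ncard_coe_finset,
    card_sdiff_add_card_eq_card (innerPts_subset S)]

open scoped Classical in
theorem convexPos_iff_card_innerPts {S : Finset (ℝ × ℝ)} :
    ConvexPos S ↔ (innerPts S).card = 0 := by
  rw [card_eq_zero, ConvexPos, innerPts, filter_eq_empty_iff]
  exact forall₂_congr fun x hx => mem_extremePoints_convexHull_iff hx

theorem GenPos.three_le_ncard_extremePoints {S : Finset (ℝ × ℝ)} (hS : GenPos S)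
    (hcard : 3 ≤ S.card) :
    3 ≤ (Set.extremePoints ℝ (convexHull ℝ (S : Set (ℝ × ℝ)))).ncard := by
  by_contra! hlt
  rw [extremePoints_convexHull_eq_sdiff, Set.ncard_coe_finset] at hlt
  obtain ⟨E, hE, -, hE2⟩ := exists_subsuperset_card_eq
    (sdiff_subset (s := S) (t := innerPts S)) (Nat.le_of_lt_succ hlt) (by omega : 2 ≤ S.card)
  obtain ⟨p, q, -, rfl⟩ := card_eq_two.1 hE2
  have hmem : ∀ x ∈ S, x ∈ line[ℝ, p, q] := by
    intro x hx
    have hx' : x ∈ convexHull ℝ (S : Set (ℝ × ℝ)) := subset_convexHull ℝ _ hx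
    rw [← convexHull_extremePoints_convexHull, extremePoints_convexHull_eq_sdiff] at hx'
    have := convexHull_subset_affineSpan _ (convexHull_mono (coe_subset.2 hE) hx')
    simpa using this
  obtain ⟨x, hx, y, hy, z, hz, hxy, hxz, hyz⟩ := two_lt_card.1 hcard
  exact hS x hx y hy z hz hxy hxz hyz
    (collinear_triple_of_mem_affineSpan_pair (hmem x hx) (hmem y hy) (hmem z hz))

theorem GenPos.card_innerPts_add_three_le {S : Finset (ℝ × ℝ)} (hS : GenPos S)
    (hcard : 3 ≤ S.card) : (innerPts S).card + 3 ≤ S.card := by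
  have h₁ := hS.three_le_ncard_extremePoints hcard
  have h₂ := ncard_extremePoints_add_card_innerPts S
  omega

theorem signedArea_ne_zero {x a b : ℝ × ℝ} (hax : a ≠ x)
    (h : ¬ Collinear ℝ ({x, a, b} : Set (ℝ × ℝ))) : signedArea x a b ≠ 0 := by
  intro h0
  apply h
  rw [collinear_iff_of_mem (p₀ := x) (by simp)]
  refine ⟨a - x, ?_⟩
  obtain ⟨a₁, a₂⟩ := a
  obtain ⟨b₁, b₂⟩ := b
  obtain ⟨x₁, x₂⟩ := x
  simp only [signedArea] at h0
  have hb : ∃ r : ℝ, b₁ - x₁ = r * (a₁ - x₁) ∧ b₂ - x₂ = r * (a₂ - x₂) := by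
    by_cases h1 : a₁ - x₁ = 0
    · have h2 : a₂ - x₂ ≠ 0 := fun h2 => hax (Prod.ext (sub_eq_zero.1 h1) (sub_eq_zero.1 h2))
      refine ⟨(b₂ - x₂) / (a₂ - x₂), ?_, by field_simp⟩
      field_simp
      linarith
    · refine ⟨(b₁ - x₁) / (a₁ - x₁), by field_simp, ?_⟩
      field_simp
      linarith
  obtain ⟨r, hr₁, hr₂⟩ := hb
  rintro p (rfl | rfl | rfl)
  · exact ⟨0, by simp⟩
  · exact ⟨1, by simp⟩
  · refine ⟨r, ?_⟩
    ext
    · simp; linarith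
    · simp; linarith

theorem mem_convexHull_triple_iff {x a b c : ℝ × ℝ} (hab : signedArea x a b ≠ 0)
    (hbc : signedArea x b c ≠ 0) (hac : signedArea x a c ≠ 0) :
    x ∈ convexHull ℝ ({a, b, c} : Set (ℝ × ℝ)) ↔
      (0 < signedArea x a b ∧ 0 < signedArea x b c ∧ signedArea x a c < 0) ∨
      (signedArea x a b < 0 ∧ signedArea x b c < 0 ∧ 0 < signedArea x a c) := by
  constructor
  · intro hx
    rw [convexHull_insert (by simp), convexHull_pair, convexJoin_singleton_left] at hx
    simp only [Set.mem_iUnion] at hx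
    obtain ⟨y, ⟨u, v, hu, hv, huv, rfl⟩, ⟨s, t, hs, ht, hst, rfl⟩⟩ := hx
    obtain rfl : u = 1 - v := by linarith
    obtain rfl : s = 1 - t := by linarith
    obtain ⟨a₁, a₂⟩ := a
    obtain ⟨b₁, b₂⟩ := b
    obtain ⟨c₁, c₂⟩ := c
    set D : ℝ := (b₁ - a₁) * (c₂ - a₂) - (b₂ - a₂) * (c₁ - a₁) with hD
    generalize hX : (1 - t) • (a₁, a₂) + t • ((1 - v) • (b₁, b₂) + v • (c₁, c₂)) = x at *
    have e₁ : signedArea x (a₁, a₂) (b₁, b₂) = t * v * D := by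
      subst hX; simp [signedArea, hD]; ring
    have e₂ : signedArea x (b₁, b₂) (c₁, c₂) = (1 - t) * D := by
      subst hX; simp [signedArea, hD]; ring
    have e₃ : signedArea x (a₁, a₂) (c₁, c₂) = -(t * (1 - v) * D) := by
      subst hX; simp [signedArea, hD]; ring
    rw [e₁] at hab ⊢
    rw [e₂] at hbc ⊢
    rw [e₃] at hac ⊢
    have h₁ : 0 < t * v := lt_of_le_of_ne (mul_nonneg ht hv) (by rintro h; simp [← h] at hab)
    have h₂ : 0 < 1 - t := lt_of_le_of_ne hs (by rintro h; simp [← h] at hbc)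
    have h₃ : 0 < t * (1 - v) :=
      lt_of_le_of_ne (mul_nonneg ht hu) (by rintro h; simp [← h] at hac)
    rcases lt_or_gt_of_ne (right_ne_zero_of_mul hab) with h | h
    · exact Or.inr ⟨mul_neg_of_pos_of_neg h₁ h, mul_neg_of_pos_of_neg h₂ h,
        neg_pos.2 (mul_neg_of_pos_of_neg h₃ h)⟩
    · exact Or.inl ⟨mul_pos h₁ h, mul_pos h₂ h, neg_neg_iff_pos.2 (mul_pos h₃ h)⟩
  · intro h
    set D := signedArea x a b + signedArea x b c - signedArea x a c with hD
    have hD0 : D ≠ 0 := by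
      rcases h with ⟨h₁, h₂, h₃⟩ | ⟨h₁, h₂, h₃⟩
      · exact (by linarith : 0 < D).ne'
      · exact (by linarith : D < 0).ne
    have hw : 0 ≤ signedArea x b c / D ∧ 0 ≤ -signedArea x a c / D ∧
        0 ≤ signedArea x a b / D := by
      rcases h with ⟨h₁, h₂, h₃⟩ | ⟨h₁, h₂, h₃⟩
      · have : 0 ≤ D := by linarith
        exact ⟨div_nonneg h₂.le this, div_nonneg (by linarith) this, div_nonneg h₁.le this⟩
      · have : D ≤ 0 := by linarith
        exact ⟨div_nonneg_of_nonpos h₂.le this, div_nonneg_of_nonpos (by linarith) this,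
          div_nonneg_of_nonpos h₁.le this⟩
    have hsum : signedArea x b c / D + -signedArea x a c / D + signedArea x a b / D = 1 := by
      field_simp
      rw [hD]
      ring
    have hx : x = (signedArea x b c / D) • a + (-signedArea x a c / D) • b +
        (signedArea x a b / D) • c := by
      obtain ⟨x₁, x₂⟩ := x
      ext
      · simp
        field_simp
        simp only [hD, signedArea]
        ring
      · simp
        field_simp
        simp only [hD, signedArea]
        ring
    have key := (convex_convexHull ℝ ({a, b, c} : Set (ℝ × ℝ))).sum_mem
      (t := univ) (w := ![signedArea x b c / D, -signedArea x a c / D, signedArea x a b / D])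
      (z := ![a, b, c])
      (by intro i _; fin_cases i <;> simp [hw])
      (by simpa [Fin.sum_univ_three] using hsum)
      (by intro i _; apply subset_convexHull ℝ; fin_cases i <;> simp)
    simp only [Fin.sum_univ_three, Matrix.cons_val] at key
    rw [hx]
    exact key

theorem signedArea_plucker (x a b c d : ℝ × ℝ) :
    signedArea x a b * signedArea x c d - signedArea x a c * signedArea x b d +
      signedArea x a d * signedArea x b c = 0 := by
  simp only [signedArea]
  ring

open scoped Classical in
theorem sum_triangle_signs_eq {p q r s t u : ℝ} (hp : p ≠ 0) (hq : q ≠ 0) (hr : r ≠ 0)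
    (hs : s ≠ 0) (ht : t ≠ 0) (hu : u ≠ 0) (h : p * u - q * t + r * s = 0) :
    let f (i j k : ℝ) : ℕ := if (0 < i ∧ 0 < j ∧ k < 0) ∨ (i < 0 ∧ j < 0 ∧ 0 < k) then 1 else 0
    f s u t + (f q u r + (f p t r + f p s q)) = 0 ∨
      f s u t + (f q u r + (f p t r + f p s q)) = 2 := by
  rcases lt_or_gt_of_ne hp with hp | hp <;> rcases lt_or_gt_of_ne hq with hq | hq <;>
  rcases lt_or_gt_of_ne hr with hr | hr <;> rcases lt_or_gt_of_ne hs with hs | hs <;>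
  rcases lt_or_gt_of_ne ht with ht | ht <;> rcases lt_or_gt_of_ne hu with hu | hu <;>
  first
  | (simp [hp, hq, hr, hs, ht, hu, hp.not_gt, hq.not_gt, hr.not_gt, hs.not_gt, ht.not_gt,
      hu.not_gt]; done)
  | (exfalso; nlinarith)

open scoped Classical in
theorem GenPos.card_filter_mem_convexHull_erase {A : Finset (ℝ × ℝ)} {x : ℝ × ℝ} (hxA : x ∉ A)
    (hA : A.card = 4) (h : GenPos (insert x A)) :
    (A.filter fun y => x ∈ convexHull ℝ (↑(A.erase y) : Set (ℝ × ℝ))).card =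
      if x ∈ convexHull ℝ (A : Set (ℝ × ℝ)) then 2 else 0 := by
  have hcount : (A.filter fun y => x ∈ convexHull ℝ (↑(A.erase y) : Set (ℝ × ℝ))).card = 0 ∨
      (A.filter fun y => x ∈ convexHull ℝ (↑(A.erase y) : Set (ℝ × ℝ))).card = 2 := by
    have hne : ∀ y ∈ A, ∀ z ∈ A, y ≠ z → signedArea x y z ≠ 0 := by
      intro y hy z hz hyz
      have hyx : y ≠ x := by rintro rfl; exact hxA hy
      have hzx : z ≠ x := by rintro rfl; exact hxA hz
      exact signedArea_ne_zero hyx (h x (by simp) y (by simp [hy]) z (by simp [hz])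
        hyx.symm hzx.symm hyz)
    obtain ⟨a, b, c, d, hab, hac, had, hbc, hbd, hcd, rfl⟩ := card_eq_four.1 hA
    have ea : ({a, b, c, d} : Finset (ℝ × ℝ)).erase a = {b, c, d} := by grind
    have eb : ({a, b, c, d} : Finset (ℝ × ℝ)).erase b = {a, c, d} := by grind
    have ec : ({a, b, c, d} : Finset (ℝ × ℝ)).erase c = {a, b, d} := by grind
    have ed : ({a, b, c, d} : Finset (ℝ × ℝ)).erase d = {a, b, c} := by grind
    have nab := hne a (by simp) b (by simp) hab
    have nac := hne a (by simp) c (by simp) hac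
    have nad := hne a (by simp) d (by simp) had
    have nbc := hne b (by simp) c (by simp) hbc
    have nbd := hne b (by simp) d (by simp) hbd
    have ncd := hne c (by simp) d (by simp) hcd
    rw [card_filter, sum_insert (by simp [hab, hac, had]), sum_insert (by simp [hbc, hbd]),
      sum_insert (by simp [hcd]), sum_singleton, ea, eb, ec, ed]
    push_cast
    rw [mem_convexHull_triple_iff nbc ncd nbd, mem_convexHull_triple_iff nac ncd nad,
      mem_convexHull_triple_iff nab nbd nad, mem_convexHull_triple_iff nab nbc nac]
    convert sum_triangle_signs_eq nab nac nad nbc nbd ncd (signedArea_plucker x a b c d)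
  split_ifs with hx
  · refine hcount.resolve_left fun h0 => ?_
    rw [card_eq_zero, filter_eq_empty_iff] at h0
    rw [convexHull_eq_union] at hx
    simp only [Set.mem_iUnion] at hx
    obtain ⟨t, htA, hind, hxt⟩ := hx
    have ht3 : t.card ≤ 3 := by
      have := hind.card_le_finrank_succ
      have h2 : Module.finrank ℝ (vectorSpan ℝ (Set.range ((↑) : t → ℝ × ℝ))) ≤
        Module.finrank ℝ (ℝ × ℝ) := Submodule.finrank_le _
      simp at this h2
      omega
    obtain ⟨y, hyA, hyt⟩ := exists_mem_notMem_of_card_lt_card (by omega : t.card < A.card)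
    refine h0 hyA (convexHull_mono (fun z hz => ?_) hxt)
    have hzy : z ≠ y := by rintro rfl; exact hyt hz
    simpa [hzy] using htA hz
  · rw [card_eq_zero, filter_eq_empty_iff]
    exact fun y _ hy => hx (convexHull_mono (by simp) hy)

theorem powersetCard_eq_image_erase {α : Type*} [DecidableEq α] {F : Finset α} {k : ℕ}
    (hF : F.card = k + 1) : F.powersetCard k = F.image F.erase := by
  ext Q
  simp only [mem_powersetCard, mem_image]
  constructor
  · rintro ⟨hQF, hQ⟩
    obtain ⟨y, hy⟩ := card_eq_one.1 (by rw [card_sdiff_of_subset hQF]; omega : (F \ Q).card = 1)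
    have hyF : y ∈ F \ Q := by simp [hy]
    refine ⟨y, (mem_sdiff.1 hyF).1, ?_⟩
    rw [erase_eq, ← hy, Finset.sdiff_sdiff_eq_self hQF]
  · rintro ⟨y, hy, rfl⟩
    exact ⟨erase_subset _ _, by rw [card_erase_of_mem hy]; omega⟩

theorem GenPos.convexPosCount_four_add {F : Finset (ℝ × ℝ)} (hF : GenPos F) (hcard : F.card = 5) :
    convexPosCount F 4 + 2 * (innerPts F).card = 5 := by
  classical
  have h₁ : convexPosCount F 4 + ∑ y ∈ F, (innerPts (F.erase y)).card = 5 := by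
    rw [convexPosCount, card_filter, powersetCard_eq_image_erase hcard,
      sum_image (erase_injOn F), ← sum_add_distrib]
    refine (sum_congr rfl fun y hy => ?_).trans (b := ∑ _y ∈ F, 1) (by simp [hcard])
    have hc : (F.erase y).card = 4 := by rw [card_erase_of_mem hy]; omega
    have := (hF.mono (erase_subset y F)).card_innerPts_add_three_le (by omega)
    rw [convexPos_iff_card_innerPts]
    split_ifs <;> omega
  have h₂ : ∑ y ∈ F, (innerPts (F.erase y)).card = 2 * (innerPts F).card := by
    have hswap : ∑ y ∈ F, (innerPts (F.erase y)).card = ∑ x ∈ F,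
        ((F.erase x).filter fun y =>
          x ∈ convexHull ℝ (↑((F.erase x).erase y) : Set (ℝ × ℝ))).card := by
      simp only [innerPts, card_eq_sum_ones]
      refine sum_comm' fun y x => ?_
      rw [mem_filter, mem_filter, erase_right_comm]
      simp only [mem_erase]
      tauto
    rw [hswap, innerPts, card_filter, mul_sum]
    refine sum_congr rfl fun x hx => ?_
    rw [GenPos.card_filter_mem_convexHull_erase (notMem_erase x F)
      (by rw [card_erase_of_mem hx]; omega) (by rwa [insert_erase hx])]
    split_ifs <;> rfl
  omega

theorem sum_convexPosCount_powersetCard_succ (P : Finset (ℝ × ℝ)) (k : ℕ) :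
    ∑ F ∈ P.powersetCard (k + 1), convexPosCount F k = (P.card - k) * convexPosCount P k := by
  classical
  have h₁ : ∑ F ∈ P.powersetCard (k + 1), convexPosCount F k =
      ∑ Q ∈ (P.powersetCard k).filter ConvexPos,
        ((P.powersetCard (k + 1)).filter fun F => Q ⊆ F).card := by
    simp only [convexPosCount, card_eq_sum_ones]
    refine sum_comm' fun F Q => ?_
    simp only [mem_filter, mem_powersetCard]
    constructor
    · rintro ⟨⟨h₁, h₂⟩, ⟨h₃, h₄⟩, h₅⟩
      exact ⟨⟨⟨h₁, h₂⟩, h₃⟩, ⟨h₃.trans h₁, h₄⟩, h₅⟩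
    · rintro ⟨⟨⟨h₁, h₂⟩, h₃⟩, ⟨-, h₄⟩, h₅⟩
      exact ⟨⟨h₁, h₂⟩, ⟨h₃, h₄⟩, h₅⟩
  rw [h₁, convexPosCount, mul_comm]
  apply sum_const_nat
  · intro Q hQ
    obtain ⟨hQP, hQ⟩ := mem_powersetCard.1 (mem_filter.1 hQ).1
    have himage : ((P.powersetCard (k + 1)).filter fun F => Q ⊆ F) =
        (P \ Q).image fun x => insert x Q := by
      ext F
      simp only [mem_filter, mem_powersetCard, mem_image, mem_sdiff]
      constructor
      · rintro ⟨⟨hFP, hF⟩, hQF⟩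
        obtain ⟨x, hx⟩ := card_eq_one.1
          (by rw [card_sdiff_of_subset hQF]; omega : (F \ Q).card = 1)
        have hxF : x ∈ F \ Q := by simp [hx]
        refine ⟨x, ⟨hFP (mem_sdiff.1 hxF).1, (mem_sdiff.1 hxF).2⟩, ?_⟩
        rw [insert_eq, ← hx, sdiff_union_of_subset hQF]
      · rintro ⟨x, ⟨hxP, hxQ⟩, rfl⟩
        exact ⟨⟨insert_subset hxP hQP, by rw [card_insert_of_notMem hxQ, hQ]⟩, subset_insert _ _⟩
    rw [himage, card_image_of_injOn, card_sdiff_of_subset hQP, hQ]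
    intro x hx y _ hxy
    have hxQ : x ∉ Q := (mem_sdiff.1 hx).2
    have : x ∈ insert y Q := by
      rw [← show insert x Q = insert y Q from hxy]
      exact mem_insert_self x Q
    exact (mem_insert.1 this).resolve_right hxQ

theorem GenPos.convexPosCount_four_eq {F : Finset (ℝ × ℝ)} (hF : GenPos F) (hcard : F.card = 5)
    (e : ℕ) (he : e = (Set.extremePoints ℝ (convexHull ℝ (F : Set (ℝ × ℝ)))).ncard) :
    convexPosCount F 4 =
      5 * (if e = 5 then 1 else 0) + 3 * (if e = 4 then 1 else 0) + (if e = 3 then 1 else 0) := by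
  have h₁ := hF.convexPosCount_four_add hcard
  have h₂ := ncard_extremePoints_add_card_innerPts F
  have h₃ := hF.three_le_ncard_extremePoints (by omega)
  split_ifs <;> omega

open scoped Classical in
theorem hullCount_eq_card_filter (P : Finset (ℝ × ℝ)) (k j : ℕ) :
    hullCount P k j = ((P.powersetCard k).filter fun S : Finset (ℝ × ℝ) =>
      (Set.extremePoints ℝ (convexHull ℝ (↑S : Set (ℝ × ℝ)))).ncard = j).card := by
  have himage : ((P.powersetCard k) >>= fun S => pure (↑S : Set (ℝ × ℝ))) =
      (P.powersetCard k).image fun S : Finset (ℝ × ℝ) => (↑S : Set (ℝ × ℝ)) := by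
    ext X
    simp only [bind_def, mem_sup, pure_def, mem_singleton, mem_image, eq_comm]
  rw [hullCount, himage, filter_image, card_image_of_injective _ coe_injective]

/-- For any point placement `P` of `n` points,
`(n − 4)·Q(P) = 5·P₅(P) + 3·U(P) + T₂(P)`. -/
theorem quad_five_subset_count (P : Finset (ℝ × ℝ)) (n : ℕ) (hgp : GenPos P)
    (hcard : P.card = n) :
    ((n : ℤ) - 4) * convexPosCount P 4 =
      5 * hullCount P 5 5 + 3 * hullCount P 5 4 + hullCount P 5 3 := by
  classical
  have hnat : (P.card - 4) * convexPosCount P 4 =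
      5 * hullCount P 5 5 + 3 * hullCount P 5 4 + hullCount P 5 3 := by
    rw [← sum_convexPosCount_powersetCard_succ]
    simp only [hullCount_eq_card_filter, card_filter, mul_sum, ← sum_add_distrib]
    refine sum_congr rfl fun F hF => ?_
    obtain ⟨hFP, hF5⟩ := mem_powersetCard.1 hF
    exact (hgp.mono hFP).convexPosCount_four_eq hF5 _ rfl
  rcases le_or_gt 4 n with hn | hn
  · rw [hcard] at hnat
    have := congrArg (Nat.cast : ℕ → ℤ) hnat
    push_cast [Nat.cast_sub hn] at this
    exact this
  · have h0 : convexPosCount P 4 = 0 := by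
      rw [convexPosCount, powersetCard_eq_empty.2 (by omega), filter_empty, card_empty]
    rw [h0, mul_zero] at hnat
    rw [h0]
    push_cast
    omega
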